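/- Let V ⊆ 𝕊 be a finite restricted reconstruction alphabet and for a ∈ A define R_Cn^{(V)}(a) := {ŝ ∈ V : Cn((S_O \ {a}) ∪ {ŝ}) = Cn(S_O)}. Assume A ≠ ∅, (H1) R_Cn^{(V)}(a) ≠ ∅ for every a ∈ A, and (H2) R_Cn^{(V)}(a₁) ∩ R_Cn^{(V)}(a₂) = ∅ for distinct a₁, a₂ ∈ A. Then the infimum of I(p,W) over all test channels W from S_O to V such that for every s with p(s) > 0 and every ŝ with W(ŝ|s) > 0 one has Cn((S_O \ {s}) ∪ {ŝ}) = Cn(S_O) equals P_A·H(π_A) (with the convention that this value is 0 when P_A = 0). Conversely, if there exists a ∈ A with p(a) > 0 and R_Cn^{(V)}(a) = ∅, then no such zero-closure-distortion test channel exists. -/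

import Mathlib

open scoped BigOperators Classical

noncomputable section

variable {𝕊 : Type*} [Fintype 𝕊]

/-- One step of the deletion procedure. -/
def atomStep (Cn : Set 𝕊 → Set 𝕊) (A : Set 𝕊) (s : 𝕊) : Set 𝕊 :=
  if s ∈ Cn (A \ {s}) then A \ {s} else A

/-- The deletion procedure; `Atom(S_O) = atomCore Cn S_O L`. -/
def atomCore (Cn : Set 𝕊 → Set 𝕊) (S : Set 𝕊) (L : List 𝕊) : Set 𝕊 :=
  L.foldl (atomStep Cn) S

/-- Shannon entropy of a probability vector on a finite type
(natural logarithm; `Real.log 0 = 0` handles the `0·log 0 := 0` convention). -/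
def entropy {X : Type*} [Fintype X] (p : X → ℝ) : ℝ :=
  -∑ x, p x * Real.log (p x)

/-- Mutual information `I(p,W) := H(p) + H(q̂) − H(q)` of a source `p` and a
channel `W`, where `q(x,y) = p(x)·W(y|x)` and `q̂` is the output marginal. -/
def mutualInfo {X Y : Type*} [Fintype X] [Fintype Y]
    (p : X → ℝ) (W : X → Y → ℝ) : ℝ :=
  entropy p + entropy (fun y => ∑ x, p x * W x y)
    - entropy (fun z : X × Y => p z.1 * W z.1 z.2)

/-- A test channel into the alphabet `Yset`: rows are probability vectors
supported inside `Yset`. -/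
def IsChannel {X Y : Type*} [Fintype Y] (W : X → Y → ℝ) (Yset : Set Y) : Prop :=
  (∀ x y, 0 ≤ W x y) ∧ (∀ x, ∑ y, W x y = 1) ∧ (∀ x y, W x y ≠ 0 → y ∈ Yset)

/-- A probability vector supported on `S`. -/
def IsProbVector {X : Type*} [Fintype X] (p : X → ℝ) (S : Set X) : Prop :=
  (∀ x, 0 ≤ p x) ∧ (∑ x, p x = 1) ∧ (∀ x, p x ≠ 0 → x ∈ S)

/-- The probability mass `p(A)` of a set `A`. -/
def massOn {X : Type*} [Fintype X] (p : X → ℝ) (A : Set X) : ℝ :=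
  ∑ x, if x ∈ A then p x else 0

/-- The conditional distribution of `p` given `A`. -/
def condOn {X : Type*} [Fintype X] (p : X → ℝ) (A : Set X) : X → ℝ :=
  fun x => if x ∈ A then p x / massOn p A else 0

/-- Zero-distortion reconstruction set
`R_Cn(s) := {shat ∈ Shat_O : Cn((S_O \ {s}) ∪ {shat}) = Cn(S_O)}`. -/
def RCn (Cn : Set 𝕊 → Set 𝕊) (S_O Shat_O : Set 𝕊) (s : 𝕊) : Set 𝕊 :=
  {shat ∈ Shat_O | Cn ((S_O \ {s}) ∪ {shat}) = Cn S_O}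

/-- The channel `W` achieves zero closure distortion for the source `p`. -/
def ZeroClosureDist (Cn : Set 𝕊 → Set 𝕊) (S_O : Set 𝕊)
    (p : 𝕊 → ℝ) (W : 𝕊 → 𝕊 → ℝ) : Prop :=
  ∀ s : 𝕊, 0 < p s → ∀ shat : 𝕊, 0 < W s shat →
    Cn ((S_O \ {s}) ∪ {shat}) = Cn S_O

/-- `R_sem(0)`: the infimum of `I(p,W)` over all zero-closure-distortion test
channels from `S_O` to `Shat_O` (infimum of the empty set is `⊤ = +∞`). -/
def RsemZero (Cn : Set 𝕊 → Set 𝕊) (S_O Shat_O : Set 𝕊) (p : 𝕊 → ℝ) : EReal :=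
  sInf {r : EReal | ∃ W : 𝕊 → 𝕊 → ℝ, IsChannel W Shat_O ∧
    ZeroClosureDist Cn S_O p W ∧ r = ((mutualInfo p W : ℝ) : EReal)}

/-- Deleting derivable statements keeps the closure and only shrinks the set. -/
theorem atomCore_subset_and_closure_eq {α : Type*} {Cn : Set α → Set α}
    (hrefl : ∀ Γ : Set α, Γ ⊆ Cn Γ)
    (hmono : ∀ Γ Γ' : Set α, Γ ⊆ Γ' → Cn Γ ⊆ Cn Γ')
    (hidem : ∀ Γ : Set α, Cn (Cn Γ) = Cn Γ) (L : List α) (S : Set α) :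
    atomCore Cn S L ⊆ S ∧ Cn (atomCore Cn S L) = Cn S := by
  induction L generalizing S with
  | nil => exact ⟨subset_rfl, rfl⟩
  | cons s L ih =>
    have hstep : atomStep Cn S s ⊆ S ∧ Cn (atomStep Cn S s) = Cn S := by
      unfold atomStep
      split_ifs with hs
      · refine ⟨Set.sdiff_subset, (hmono _ _ Set.sdiff_subset).antisymm ?_⟩
        rw [← hidem (S \ {s})]
        refine hmono _ _ fun x hx => ?_
        by_cases hxs : x = s
        · exact hxs ▸ hs
        · exact hrefl _ ⟨hx, hxs⟩
      · exact ⟨subset_rfl, rfl⟩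
    obtain ⟨h₁, h₂⟩ := ih (atomStep Cn S s)
    exact ⟨h₁.trans hstep.1, h₂.trans hstep.2⟩

theorem mutualInfo_eq_sum {X Y : Type*} [Fintype X] [Fintype Y]
    (p : X → ℝ) {W : X → Y → ℝ} (hW : ∀ x, ∑ y, W x y = 1) :
    mutualInfo p W = ∑ x, ∑ y, p x * W x y *
      (Real.log (W x y) - Real.log (∑ x', p x' * W x' y)) := by
  have hin : ∑ x, p x * Real.log (p x) = ∑ x, ∑ y, p x * W x y * Real.log (p x) := by
    refine Finset.sum_congr rfl fun x _ => ?_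
    rw [← Finset.sum_mul, ← Finset.mul_sum, hW, mul_one]
  have hout : ∑ y, (∑ x, p x * W x y) * Real.log (∑ x, p x * W x y) =
      ∑ x, ∑ y, p x * W x y * Real.log (∑ x', p x' * W x' y) := by
    rw [Finset.sum_comm]
    exact Finset.sum_congr rfl fun y _ => Finset.sum_mul _ _ _
  have hjoint : ∑ z : X × Y, p z.1 * W z.1 z.2 * Real.log (p z.1 * W z.1 z.2) =
      ∑ x, ∑ y, (p x * W x y * Real.log (p x) + p x * W x y * Real.log (W x y)) := by
    rw [Fintype.sum_prod_type]
    refine Finset.sum_congr rfl fun x _ => Finset.sum_congr rfl fun y _ => ?_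
    by_cases hp : p x = 0
    · simp [hp]
    by_cases hw : W x y = 0
    · simp [hw]
    rw [Real.log_mul hp hw, mul_add]
  unfold mutualInfo entropy
  rw [hin, hout, hjoint]
  simp only [mul_sub, Finset.sum_add_distrib, Finset.sum_sub_distrib]
  ring

theorem mutualInfo_eq_entropy_sub {X Y : Type*} [Fintype X] [Fintype Y]
    (p : X → ℝ) {W : X → Y → ℝ} (hW : ∀ x, ∑ y, W x y = 1) :
    mutualInfo p W = entropy (fun y => ∑ x, p x * W x y) - ∑ x, p x * entropy (W x) := by
  rw [mutualInfo_eq_sum p hW]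
  simp only [entropy, mul_sub, Finset.sum_sub_distrib, mul_neg, Finset.sum_neg_distrib,
    Finset.mul_sum, Finset.sum_mul, mul_assoc]
  rw [Finset.sum_comm (f := fun x y => p x * (W x y * Real.log (∑ x', p x' * W x' y)))]
  ring

/-- Variational lower bound on mutual information. -/
theorem sum_mul_log_le_mutualInfo {X Y : Type*} [Fintype X] [Fintype Y]
    {p : X → ℝ} {W g : X → Y → ℝ} (hp : ∀ x, 0 ≤ p x) (hp1 : ∑ x, p x = 1)
    (hW : ∀ x y, 0 ≤ W x y) (hW1 : ∀ x, ∑ y, W x y = 1)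
    (hg : ∀ x y, 0 ≤ g x y) (hgpos : ∀ x y, 0 < p x → 0 < W x y → 0 < g x y)
    (hg1 : ∀ y, ∑ x, p x * g x y ≤ 1) :
    ∑ x, ∑ y, p x * W x y * Real.log (g x y) ≤ mutualInfo p W := by
  rw [mutualInfo_eq_sum p hW1, ← sub_nonneg, ← Finset.sum_sub_distrib]
  simp only [← Finset.sum_sub_distrib]
  set m : Y → ℝ := fun y => ∑ x, p x * W x y
  have hm : ∀ y, 0 ≤ m y := fun y =>
    Finset.sum_nonneg fun x _ => mul_nonneg (hp x) (hW x y)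
  have hpW : ∑ x, ∑ y, p x * W x y = 1 := by
    simp only [← Finset.mul_sum, hW1, mul_one, hp1]
  have hm1 : ∑ y, m y = 1 := by rw [← hpW, Finset.sum_comm]
  have hle : ∑ x, ∑ y, m y * (p x * g x y) ≤ 1 := by
    rw [Finset.sum_comm, ← hm1]
    refine Finset.sum_le_sum fun y _ => ?_
    rw [← Finset.mul_sum]
    exact mul_le_of_le_one_right (hm y) (hg1 y)
  have hterm : ∀ x y, p x * W x y - m y * (p x * g x y) ≤
      p x * W x y * (Real.log (W x y) - Real.log (m y)) -
        p x * W x y * Real.log (g x y) := by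
    intro x y
    have hr := mul_nonneg (hm y) (mul_nonneg (hp x) (hg x y))
    rcases (hp x).eq_or_lt with h0 | h0
    · simp [← h0]
    rcases (hW x y).eq_or_lt with h1 | h1
    · simp only [← h1]; linarith
    have hmy : 0 < m y := (mul_pos h0 h1).trans_le
      (Finset.single_le_sum (f := fun x => p x * W x y)
        (fun x _ => mul_nonneg (hp x) (hW x y)) (Finset.mem_univ x))
    have hgy := hgpos x y h0 h1
    have hlog := Real.log_le_sub_one_of_pos (div_pos (mul_pos hmy hgy) h1)
    rw [Real.log_div (mul_pos hmy hgy).ne' h1.ne', Real.log_mul hmy.ne' hgy.ne'] at hlog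
    have hmul := mul_le_mul_of_nonneg_left hlog (mul_pos h0 h1).le
    have hcancel : p x * W x y * (m y * g x y / W x y - 1) =
        m y * (p x * g x y) - p x * W x y := by field_simp
    linarith
  have hsum := Finset.sum_le_sum fun x (_ : x ∈ Finset.univ) =>
    Finset.sum_le_sum fun y (_ : y ∈ Finset.univ) => hterm x y
  simp only [Finset.sum_sub_distrib] at hsum hpW hle ⊢
  linarith

theorem massOn_nonneg {X : Type*} [Fintype X] {p : X → ℝ} (hp : ∀ x, 0 ≤ p x) (A : Set X) :
    0 ≤ massOn p A :=
  Finset.sum_nonneg fun x _ => by split_ifs <;> simp [hp]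

theorem le_massOn {X : Type*} [Fintype X] {p : X → ℝ} (hp : ∀ x, 0 ≤ p x) {A : Set X}
    {a : X} (ha : a ∈ A) : p a ≤ massOn p A := by
  have h := Finset.single_le_sum (f := fun x => if x ∈ A then p x else 0)
    (fun x _ => by split_ifs <;> simp [hp]) (Finset.mem_univ a)
  simpa [massOn, ha] using h

theorem massOn_mul_condOn {X : Type*} [Fintype X] {p : X → ℝ} (hp : ∀ x, 0 ≤ p x)
    (A : Set X) (x : X) :
    massOn p A * condOn p A x = if x ∈ A then p x else 0 := by
  unfold condOn
  split_ifs with hx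
  · by_cases h : massOn p A = 0
    · have := le_massOn hp hx
      have := hp x
      rw [h]; linarith
    · field_simp
  · simp

theorem massOn_mul_entropy_condOn {X : Type*} [Fintype X] {p : X → ℝ} (hp : ∀ x, 0 ≤ p x)
    (A : Set X) :
    massOn p A * entropy (condOn p A) =
      ∑ x, if x ∈ A then p x * Real.log (massOn p A / p x) else 0 := by
  unfold entropy
  rw [mul_neg, Finset.mul_sum, ← Finset.sum_neg_distrib]
  refine Finset.sum_congr rfl fun x _ => ?_
  rw [← mul_assoc, massOn_mul_condOn hp]
  split_ifs with hx
  · rw [condOn, if_pos hx, ← mul_neg, ← Real.log_inv, inv_div]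
  · simp

/-- Lower bound: outputs of core symbols lying in pairwise disjoint sets reveal the core. -/
theorem massOn_mul_entropy_condOn_le_mutualInfo {X Y : Type*} [Fintype X] [Fintype Y]
    {p : X → ℝ} {W : X → Y → ℝ} {A : Set X} {R : X → Set Y}
    (hp : ∀ x, 0 ≤ p x) (hp1 : ∑ x, p x = 1)
    (hW : ∀ x y, 0 ≤ W x y) (hW1 : ∀ x, ∑ y, W x y = 1)
    (hR : ∀ a ∈ A, ∀ y, 0 < p a → 0 < W a y → y ∈ R a)
    (hdisj : ∀ a₁ ∈ A, ∀ a₂ ∈ A, a₁ ≠ a₂ → R a₁ ∩ R a₂ = ∅) :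
    massOn p A * entropy (condOn p A) ≤ mutualInfo p W := by
  set P := massOn p A with hP
  have hP0 : 0 ≤ P := massOn_nonneg hp A
  let g : X → Y → ℝ := fun x y => if x ∈ A then (if y ∈ R x then P / p x else 0) else 1
  have hcompl : ∑ x, (if x ∈ A then 0 else p x) = 1 - P := by
    rw [← hp1, hP, massOn, ← Finset.sum_sub_distrib]
    exact Finset.sum_congr rfl fun x _ => by split_ifs <;> simp
  refine le_of_eq_of_le ?_ (sum_mul_log_le_mutualInfo (g := g) hp hp1 hW hW1 ?_ ?_ ?_)
  · rw [massOn_mul_entropy_condOn hp]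
    refine Finset.sum_congr rfl fun x _ => ?_
    split_ifs with hx
    · rw [← mul_one (p x * _), ← hW1 x, Finset.mul_sum]
      refine Finset.sum_congr rfl fun y _ => ?_
      rcases (hp x).eq_or_lt with h0 | h0
      · simp [← h0]
      rcases (hW x y).eq_or_lt with h1 | h1
      · simp [← h1]
      simp only [g, if_pos hx, if_pos (hR x hx y h0 h1)]
      ring
    · simp [g, hx]
  · intro x y
    have := div_nonneg hP0 (hp x)
    dsimp only [g]
    split_ifs <;> simp [this]
  · intro x y h0 h1
    dsimp only [g]
    by_cases hx : x ∈ A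
    · rw [if_pos hx, if_pos (hR x hx y h0 h1)]
      exact div_pos (h0.trans_le (le_massOn hp hx)) h0
    · simp [hx]
  · intro y
    have hcore : ∑ x, (if x ∈ A ∧ y ∈ R x then p x * (P / p x) else 0) ≤ P := by
      by_cases h : ∃ a ∈ A, y ∈ R a
      · obtain ⟨a, ha, hya⟩ := h
        rw [Finset.sum_eq_single a]
        · rw [if_pos ⟨ha, hya⟩]
          by_cases h0 : p a = 0
          · simpa [h0] using hP0
          · exact (mul_div_cancel₀ P h0).le
        · rintro b - hb
          refine if_neg fun ⟨hbA, hyb⟩ => ?_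
          have : y ∈ R b ∩ R a := ⟨hyb, hya⟩
          simp [hdisj b hbA a ha hb] at this
        · simp
      · push Not at h
        rw [Finset.sum_eq_zero fun x _ => if_neg fun hx => h x hx.1 hx.2]
        exact hP0
    have hsplit : ∑ x, p x * g x y =
        ∑ x, (if x ∈ A ∧ y ∈ R x then p x * (P / p x) else 0) +
          ∑ x, (if x ∈ A then 0 else p x) := by
      rw [← Finset.sum_add_distrib]
      refine Finset.sum_congr rfl fun x _ => ?_
      by_cases hx : x ∈ A <;> by_cases hy : y ∈ R x <;> simp [g, hx, hy]
    rw [hsplit, hcompl]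
    linarith

theorem entropy_pushforward_le {X Y : Type*} [Fintype X] [Fintype Y] {μ : X → ℝ}
    (hμ : ∀ x, 0 ≤ μ x) (r : X → Y) :
    entropy (fun y => ∑ x, if r x = y then μ x else 0) ≤ entropy μ := by
  set ν : Y → ℝ := fun y => ∑ x, if r x = y then μ x else 0 with hν
  have hsum : ∑ y, ν y * Real.log (ν y) = ∑ x, μ x * Real.log (ν (r x)) := by
    simp_rw [hν, Finset.sum_mul]
    rw [Finset.sum_comm]
    refine Finset.sum_congr rfl fun x _ => ?_
    rw [Finset.sum_eq_single (r x)]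
    · simp
    · intro y _ hy
      simp [hy.symm]
    · simp
  unfold entropy
  rw [hsum, neg_le_neg_iff]
  refine Finset.sum_le_sum fun x _ => ?_
  rcases (hμ x).eq_or_lt with h0 | h0
  · simp [← h0]
  have hle : μ x ≤ ν (r x) := by
    have h := Finset.single_le_sum (f := fun x' => if r x' = r x then μ x' else 0)
      (fun x' _ => by split_ifs <;> simp [hμ]) (Finset.mem_univ x)
    simpa using h
  exact mul_le_mul_of_nonneg_left (Real.log_le_log h0 hle) h0.le

/-- A core law representing `p` on `A`, also defined when `A` has mass zero. -/
theorem exists_core_law {X : Type*} [Fintype X] {p : X → ℝ} (hp : ∀ x, 0 ≤ p x)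
    {A : Set X} (hA : A.Nonempty) :
    ∃ μ : X → ℝ, (∀ x, 0 ≤ μ x) ∧ ∑ x, μ x = 1 ∧ (∀ x, μ x ≠ 0 → x ∈ A) ∧
      (∀ x, massOn p A * μ x = if x ∈ A then p x else 0) ∧
      massOn p A * entropy μ = massOn p A * entropy (condOn p A) := by
  by_cases h : massOn p A = 0
  · obtain ⟨a, ha⟩ := hA
    refine ⟨fun x => if x = a then 1 else 0, fun x => by dsimp only; split_ifs <;> simp,
      by simp, fun x hx => ?_, fun x => ?_, by simp [h]⟩
    · have : x = a := by simpa using hx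
      exact this ▸ ha
    · rw [← massOn_mul_condOn hp, h, zero_mul, zero_mul]
  · refine ⟨condOn p A, fun x => ?_, ?_, fun x hx => ?_, massOn_mul_condOn hp A, rfl⟩
    · unfold condOn
      split_ifs
      · exact div_nonneg (hp x) (massOn_nonneg hp A)
      · exact le_rfl
    · apply mul_left_cancel₀ h
      rw [Finset.mul_sum, mul_one]
      simp only [massOn_mul_condOn hp]
      rfl
    · by_contra hxA
      simp [condOn, hxA] at hx

/-- Upper bound: encode core symbols by `r` and randomize all others by the core law. -/
theorem exists_channel_mutualInfo_le {X Y : Type*} [Fintype X] [Fintype Y]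
    {p : X → ℝ} (hp : ∀ x, 0 ≤ p x) (hp1 : ∑ x, p x = 1)
    {A : Set X} (hA : A.Nonempty) (r : X → Y) :
    ∃ W : X → Y → ℝ, IsChannel W (r '' A) ∧
      (∀ a ∈ A, ∀ y, W a y ≠ 0 → y = r a) ∧
      mutualInfo p W ≤ massOn p A * entropy (condOn p A) := by
  obtain ⟨μ, hμ, hμ1, hμA, hμp, hμe⟩ := exists_core_law hp hA
  let ν : Y → ℝ := fun y => ∑ x, if r x = y then μ x else 0
  let W : X → Y → ℝ := fun x y => if x ∈ A then (if r x = y then 1 else 0) else ν y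
  have hν : ∀ y, 0 ≤ ν y := fun y =>
    Finset.sum_nonneg fun x _ => by split_ifs <;> simp [hμ]
  have hν1 : ∑ y, ν y = 1 := by
    dsimp only [ν]
    rw [Finset.sum_comm]
    simpa using hμ1
  have hW1 : ∀ x, ∑ y, W x y = 1 := by
    intro x
    by_cases hx : x ∈ A
    · simp [W, hx]
    · simpa [W, hx] using hν1
  have hcompl : ∑ x, (if x ∈ A then 0 else p x) = 1 - massOn p A := by
    rw [← hp1, massOn, ← Finset.sum_sub_distrib]
    exact Finset.sum_congr rfl fun x _ => by split_ifs <;> simp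
  have hout : (fun y => ∑ x, p x * W x y) = ν := by
    funext y
    have hcore : ∑ x, (if x ∈ A then (if r x = y then p x else 0) else 0) =
        massOn p A * ν y := by
      dsimp only [ν]
      rw [Finset.mul_sum]
      refine Finset.sum_congr rfl fun x _ => ?_
      rw [mul_ite, mul_zero, hμp]
      split_ifs <;> rfl
    have hsplit : ∑ x, p x * W x y =
        ∑ x, (if x ∈ A then (if r x = y then p x else 0) else 0) +
          (∑ x, (if x ∈ A then 0 else p x)) * ν y := by
      rw [Finset.sum_mul, ← Finset.sum_add_distrib]
      refine Finset.sum_congr rfl fun x _ => ?_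
      by_cases hx : x ∈ A <;> simp [W, hx]
    rw [hsplit, hcore, hcompl]
    ring
  refine ⟨W, ⟨fun x y => ?_, hW1, fun x y hxy => ?_⟩, fun a ha y hy => ?_, ?_⟩
  · dsimp only [W]
    split_ifs <;> simp [hν]
  · by_cases hx : x ∈ A
    · have : r x = y := by simpa [W, hx] using hxy
      exact ⟨x, hx, this⟩
    · have hνy : ν y ≠ 0 := by simpa [W, hx] using hxy
      obtain ⟨a, -, ha⟩ := Finset.exists_ne_zero_of_sum_ne_zero hνy
      have ha' : r a = y ∧ μ a ≠ 0 := by simpa using ha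
      exact ⟨a, hμA a ha'.2, ha'.1⟩
  · have : r a = y := by simpa [W, ha] using hy
    exact this.symm
  · have hcond : ∑ x, p x * entropy (W x) = (1 - massOn p A) * entropy ν := by
      rw [← hcompl, Finset.sum_mul]
      refine Finset.sum_congr rfl fun x _ => ?_
      by_cases hx : x ∈ A
      · simp [entropy, W, hx]
      · have : W x = ν := funext fun y => if_neg hx
        rw [this, if_neg hx]
    rw [mutualInfo_eq_entropy_sub p hW1, hout, hcond, ← hμe]
    have := mul_le_mul_of_nonneg_left (entropy_pushforward_le hμ r) (massOn_nonneg hp A)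
    change massOn p A * entropy ν ≤ _ at this
    linarith

/-- Heterogeneous zero-distortion extension: for a
restricted reconstruction alphabet `V`, if `A ≠ ∅`, every core symbol has a
zero-distortion representative in `V` (H1), and these representative sets are
pairwise disjoint (H2), then the restricted zero-distortion rate equals
`P_A·H(π_A)` (which is `0` when `P_A = 0`, automatically since then
`π_A ≡ 0`). Conversely, if some core symbol of positive probability has no
representative in `V`, then no zero-closure-distortion channel into `V`
exists. -/
theorem heterogeneous_zero_distortion
    (Cn : Set 𝕊 → Set 𝕊)
    (hrefl : ∀ Γ : Set 𝕊, Γ ⊆ Cn Γ)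
    (hmono : ∀ Γ Γ' : Set 𝕊, Γ ⊆ Γ' → Cn Γ ⊆ Cn Γ')
    (hidem : ∀ Γ : Set 𝕊, Cn (Cn Γ) = Cn Γ)
    (S_O V : Set 𝕊) (L : List 𝕊)
    (hnodup : L.Nodup)
    (henum : ∀ s : 𝕊, s ∈ L ↔ s ∈ S_O)
    (p : 𝕊 → ℝ) (hp : IsProbVector p S_O) :
    ((atomCore Cn S_O L).Nonempty →
      (∀ a ∈ atomCore Cn S_O L, (RCn Cn S_O V a).Nonempty) →
      (∀ a₁ ∈ atomCore Cn S_O L, ∀ a₂ ∈ atomCore Cn S_O L, a₁ ≠ a₂ →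
        RCn Cn S_O V a₁ ∩ RCn Cn S_O V a₂ = ∅) →
      RsemZero Cn S_O V p =
        ((massOn p (atomCore Cn S_O L) *
            entropy (condOn p (atomCore Cn S_O L)) : ℝ) : EReal)) ∧
    ((∃ a ∈ atomCore Cn S_O L, 0 < p a ∧ RCn Cn S_O V a = ∅) →
      ∀ W : 𝕊 → 𝕊 → ℝ, ¬(IsChannel W V ∧ ZeroClosureDist Cn S_O p W)) := by
  obtain ⟨hp0, hp1, -⟩ := hp
  obtain ⟨hsub, hcl⟩ := atomCore_subset_and_closure_eq hrefl hmono hidem L S_O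
  set A := atomCore Cn S_O L
  refine ⟨fun hA hne hdisj => le_antisymm ?_ ?_, ?_⟩
  · choose! r hr using hne
    obtain ⟨W, ⟨hW, hW1, hWA⟩, hWr, hI⟩ := exists_channel_mutualInfo_le hp0 hp1 hA r
    refine sInf_le_of_le (b := ((mutualInfo p W : ℝ) : EReal))
      ⟨W, ⟨hW, hW1, fun x y hxy => ?_⟩, fun s _ y hy => ?_, rfl⟩ (EReal.coe_le_coe_iff.2 hI)
    · obtain ⟨a, ha, rfl⟩ := hWA x y hxy
      exact (hr a ha).1
    · by_cases hs : s ∈ A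
      · rw [hWr s hs y hy.ne']
        exact (hr s hs).2
      obtain ⟨a, ha, rfl⟩ := hWA s y hy.ne'
      have hmem : r a ∈ Cn S_O := (hr a ha).2 ▸ hrefl _ (Or.inr rfl)
      apply Set.Subset.antisymm
      · rw [← hidem S_O]
        refine hmono _ _ (Set.union_subset (Set.sdiff_subset.trans (hrefl _)) ?_)
        simpa using hmem
      · rw [← hcl]
        exact hmono _ _ fun x hx => Or.inl ⟨hsub hx, fun h => hs (h ▸ hx)⟩
  · refine le_sInf ?_
    rintro _ ⟨W, ⟨hW, hW1, hWV⟩, hzero, rfl⟩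
    exact EReal.coe_le_coe_iff.2 (massOn_mul_entropy_condOn_le_mutualInfo
      (R := RCn Cn S_O V) hp0 hp1 hW hW1
      (fun a _ y h0 h1 => ⟨hWV a y h1.ne', hzero a h0 y h1⟩) hdisj)
  · rintro ⟨a, -, ha, hempty⟩ W ⟨⟨hW, hW1, hWV⟩, hzero⟩
    obtain ⟨y, -, hy⟩ := Finset.exists_ne_zero_of_sum_ne_zero
      ((hW1 a).trans_ne one_ne_zero)
    have hmem : y ∈ RCn Cn S_O V a :=
      ⟨hWV a y hy, hzero a ha y ((hW a y).lt_of_ne' hy)⟩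
    simp [hempty] at hmem

end
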